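/- Under the hypotheses of Theorem 4.4 (range condition and step-size condition of Algorithm 4.3), let x̄ be the optimal solution of the primal problem (P) to which x_n converges weakly. If in addition h is uniformly convex at x̄, i.e. there exists an increasing function φ : [0,+∞) → [0,+∞] vanishing only at 0 such that h(λx + (1−λ)x̄) ≤ λh(x) + (1−λ)h(x̄) − λ(1−λ)φ(‖x − x̄‖) for all x ∈ dom h and λ ∈ (0,1), then x_n → x̄ strongly in H as n → +∞. -/

import Mathlib

open scoped RealInnerProductSpace ENNReal
open Filter Topology

noncomputable section

/-- `f ∈ Γ(E)`: proper, convex and lower semicontinuous -/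
def ProperConvLsc {E : Type*} [NormedAddCommGroup E] [InnerProductSpace ℝ E]
    (f : E → EReal) : Prop :=
  (∃ x, f x ≠ ⊤) ∧ (∀ x, f x ≠ ⊥) ∧
  (∀ x y : E, ∀ a b : ℝ, 0 ≤ a → 0 ≤ b → a + b = 1 →
    f (a • x + b • y) ≤ (a : EReal) * f x + (b : EReal) * f y) ∧
  LowerSemicontinuous f

/-- Fenchel conjugate -/
def econj {E : Type*} [NormedAddCommGroup E] [InnerProductSpace ℝ E]
    (f : E → EReal) (p : E) : EReal :=
  ⨆ x : E, ((⟪p, x⟫ : ℝ) : EReal) - f x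

/-- infimal convolution -/
def einfConv {E : Type*} [AddGroup E] (f g : E → EReal) (x : E) : EReal :=
  ⨅ y : E, f y + g (x - y)

/-- convex subdifferential -/
def esubdiff {E : Type*} [NormedAddCommGroup E] [InnerProductSpace ℝ E]
    (f : E → EReal) (x : E) : Set E :=
  {p | f x ≠ ⊤ ∧ f x ≠ ⊥ ∧ ∀ y, f x + ((⟪p, y - x⟫ : ℝ) : EReal) ≤ f y}

/-- effective domain -/
def edom {E : Type*} (f : E → EReal) : Set E := {x | f x ≠ ⊤}

def invOp {E : Type*} (A : E → Set E) : E → Set E := fun u => {x | u ∈ A x}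

def sumOp {E : Type*} [Add E] (A B : E → Set E) : E → Set E :=
  fun x => {s | ∃ u ∈ A x, ∃ v ∈ B x, s = u + v}

/-- parallel sum `A □ B = (A⁻¹ + B⁻¹)⁻¹` -/
def parOp {E : Type*} [Add E] (A B : E → Set E) : E → Set E :=
  invOp (sumOp (invOp A) (invOp B))

/-- `T* ∘ B ∘ T` -/
def compOp {F G : Type*} [NormedAddCommGroup F] [InnerProductSpace ℝ F] [CompleteSpace F]
    [NormedAddCommGroup G] [InnerProductSpace ℝ G] [CompleteSpace G]
    (T : F →L[ℝ] G) (B : G → Set G) : F → Set F :=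
  fun x => (ContinuousLinearMap.adjoint T) '' (B (T x))

/-- `x = Prox_{γ f}(w)`: `x` minimizes `u ↦ γ f(u) + ‖u - w‖²/2` -/
def IsProx {E : Type*} [NormedAddCommGroup E] [InnerProductSpace ℝ E]
    (γ : ℝ) (f : E → EReal) (w x : E) : Prop :=
  ∀ u : E, (γ : EReal) * f x + ((‖x - w‖ ^ 2 / 2 : ℝ) : EReal) ≤
    (γ : EReal) * f u + ((‖u - w‖ ^ 2 / 2 : ℝ) : EReal)

/-- weak convergence in a Hilbert space -/
def WConv {E : Type*} [NormedAddCommGroup E] [InnerProductSpace ℝ E] (u : ℕ → E) (l : E) : Prop :=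
  ∀ w : E, Tendsto (fun n => ⟪u n, w⟫) atTop (𝓝 ⟪l, w⟫)

/-- the objective value of the primal problem (P) -/
def Pval {m : ℕ}
    {H : Type*} [NormedAddCommGroup H] [InnerProductSpace ℝ H] [CompleteSpace H]
    {G : Fin m → Type*} [∀ i, NormedAddCommGroup (G i)] [∀ i, InnerProductSpace ℝ (G i)]
    [∀ i, CompleteSpace (G i)]
    {X : Fin m → Type*} [∀ i, NormedAddCommGroup (X i)] [∀ i, InnerProductSpace ℝ (X i)]
    [∀ i, CompleteSpace (X i)]
    {Y : Fin m → Type*} [∀ i, NormedAddCommGroup (Y i)] [∀ i, InnerProductSpace ℝ (Y i)]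
    [∀ i, CompleteSpace (Y i)]
    (z : H) (f : H → EReal) (h : H → ℝ)
    (g : ∀ i, X i → EReal) (l : ∀ i, Y i → EReal) (r : ∀ i, G i)
    (L : ∀ i, H →L[ℝ] G i) (K : ∀ i, G i →L[ℝ] X i) (M : ∀ i, G i →L[ℝ] Y i)
    (x : H) : EReal :=
  f x + (∑ i, einfConv (fun w => g i (K i w)) (fun w => l i (M i w)) (L i x - r i)) +
    ((h x - ⟪x, z⟫ : ℝ) : EReal)

/-- the objective value of the dual problem (D) -/
def Dval {m : ℕ}
    {H : Type*} [NormedAddCommGroup H] [InnerProductSpace ℝ H] [CompleteSpace H]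
    {G : Fin m → Type*} [∀ i, NormedAddCommGroup (G i)] [∀ i, InnerProductSpace ℝ (G i)]
    [∀ i, CompleteSpace (G i)]
    {X : Fin m → Type*} [∀ i, NormedAddCommGroup (X i)] [∀ i, InnerProductSpace ℝ (X i)]
    [∀ i, CompleteSpace (X i)]
    {Y : Fin m → Type*} [∀ i, NormedAddCommGroup (Y i)] [∀ i, InnerProductSpace ℝ (Y i)]
    [∀ i, CompleteSpace (Y i)]
    (z : H) (f : H → EReal) (h : H → ℝ)
    (g : ∀ i, X i → EReal) (l : ∀ i, Y i → EReal) (r : ∀ i, G i)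
    (L : ∀ i, H →L[ℝ] G i) (K : ∀ i, G i →L[ℝ] X i) (M : ∀ i, G i →L[ℝ] Y i)
    (p : ∀ i, X i) (q : ∀ i, Y i) : EReal :=
  - einfConv (econj f) (econj (fun x => (h x : EReal)))
      (z - ∑ i, ContinuousLinearMap.adjoint (L i) (ContinuousLinearMap.adjoint (K i) (p i)))
    - ∑ i, (econj (g i) (p i) + econj (l i) (q i) + ((⟪p i, K i (r i)⟫ : ℝ) : EReal))


theorem coe_inner_sub_le_econj {E : Type*} [NormedAddCommGroup E] [InnerProductSpace ℝ E]
    {g : E → EReal} {x : E} {c : ℝ} (hgx : g x = c) (p : E) :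
    ((⟪p, x⟫ - c : ℝ) : EReal) ≤ econj g p := by
  rw [EReal.coe_sub, ← hgx]
  exact le_iSup (fun x : E => ((⟪p, x⟫ : ℝ) : EReal) - g x) x

theorem econj_ne_bot {E : Type*} [NormedAddCommGroup E] [InnerProductSpace ℝ E]
    {g : E → EReal} (hg : ∃ x, g x ≠ ⊤) (p : E) : econj g p ≠ ⊥ := by
  obtain ⟨x, hx⟩ := hg
  have h1 : ((⟪p, x⟫ : ℝ) : EReal) - g x ≤ econj g p :=
    le_iSup (fun x : E => ((⟪p, x⟫ : ℝ) : EReal) - g x) x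
  intro h2
  rw [h2, le_bot_iff] at h1
  induction hgx : g x with
  | bot => simp [hgx] at h1
  | top => exact hx hgx
  | coe c => rw [hgx] at h1; exact EReal.coe_ne_bot _ h1

theorem econj_convex {E : Type*} [NormedAddCommGroup E] [InnerProductSpace ℝ E]
    {g : E → EReal} (hbot : ∀ x, g x ≠ ⊥) (p q : E) (a b : ℝ) (ha : 0 ≤ a) (hb : 0 ≤ b)
    (hab : a + b = 1) :
    econj g (a • p + b • q) ≤ (a : EReal) * econj g p + (b : EReal) * econj g q := by
  refine iSup_le fun x => ?_
  induction hgx : g x with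
  | bot => exact absurd hgx (hbot x)
  | top => simp
  | coe c =>
    have key := coe_inner_sub_le_econj hgx
    have h1 := add_le_add (mul_le_mul_of_nonneg_left (key p) (EReal.coe_nonneg.2 ha))
      (mul_le_mul_of_nonneg_left (key q) (EReal.coe_nonneg.2 hb))
    refine le_trans (le_of_eq ?_) h1
    rw [← EReal.coe_sub, ← EReal.coe_mul, ← EReal.coe_mul, ← EReal.coe_add]
    congr 1
    rw [inner_add_left, real_inner_smul_left, real_inner_smul_left]
    linear_combination c * hab

theorem mem_esubdiff_econj {E : Type*} [NormedAddCommGroup E] [InnerProductSpace ℝ E]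
    {g : E → EReal} {x p : E} (h : p ∈ esubdiff g x) : x ∈ esubdiff (econj g) p := by
  obtain ⟨htop, hbot, hsub⟩ := h
  lift g x to ℝ using ⟨htop, hbot⟩ with c hc
  have hle := coe_inner_sub_le_econj hc.symm
  have heq : econj g p = ((⟪p, x⟫ - c : ℝ) : EReal) := by
    refine le_antisymm (iSup_le fun y => ?_) (hle p)
    have hy := hsub y
    induction hgy : g y with
    | bot => simp [hgy, ← EReal.coe_add] at hy
    | top => simp
    | coe d =>
      rw [hgy, ← EReal.coe_add, EReal.coe_le_coe_iff, inner_sub_right] at hy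
      rw [← EReal.coe_sub, EReal.coe_le_coe_iff]
      linarith
  refine ⟨heq ▸ EReal.coe_ne_top _, heq ▸ EReal.coe_ne_bot _, fun q => ?_⟩
  rw [heq, ← EReal.coe_add]
  refine le_trans (le_of_eq ?_) (hle q)
  congr 1
  rw [inner_sub_right, real_inner_comm x q, real_inner_comm x p]
  ring

/-- Monotonicity of the subdifferential, tested between a proximal point and a given point of
the graph. -/
theorem IsProx.inner_nonneg {E : Type*} [NormedAddCommGroup E] [InnerProductSpace ℝ E]
    {F : E → EReal} (hbot : ∀ x, F x ≠ ⊥)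
    (hconv : ∀ x y : E, ∀ a b : ℝ, 0 ≤ a → 0 ≤ b → a + b = 1 →
      F (a • x + b • y) ≤ (a : EReal) * F x + (b : EReal) * F y)
    {γ : ℝ} (hγ : 0 < γ) {w j : E} (hj : IsProx γ F w j) {p s : E} (hs : s ∈ esubdiff F p) :
    0 ≤ ⟪w - j - γ • s, j - p⟫ := by
  obtain ⟨htop, -, hsub⟩ := hs
  have hsj := hsub j
  have hFp := hbot p
  have hjp := hj p
  have hFj : F j ≠ ⊤ := by
    intro h
    lift F p to ℝ using ⟨htop, hFp⟩ with c
    rw [h, EReal.coe_mul_top_of_pos hγ, EReal.top_add_coe, ← EReal.coe_mul, ← EReal.coe_add,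
      top_le_iff] at hjp
    exact EReal.coe_ne_top _ hjp
  obtain ⟨c, hc⟩ : ∃ c : ℝ, F p = c := ⟨_, (EReal.coe_toReal htop hFp).symm⟩
  obtain ⟨d, hd⟩ : ∃ d : ℝ, F j = d := ⟨_, (EReal.coe_toReal hFj (hbot j)).symm⟩
  rw [hc, hd, ← EReal.coe_add, EReal.coe_le_coe_iff] at hsj
  have main : ∀ t : ℝ, t ∈ Set.Ioc (0 : ℝ) 1 →
      γ * d ≤ γ * c + ⟪j - w, p - j⟫ + t * (‖p - j‖ ^ 2 / 2) := by
    rintro t ⟨ht0, ht1⟩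
    have h1 := hconv j p (1 - t) t (by linarith) ht0.le (by ring)
    have h2 := hj ((1 - t) • j + t • p)
    have hb := hbot ((1 - t) • j + t • p)
    rw [hc, hd, ← EReal.coe_mul, ← EReal.coe_mul, ← EReal.coe_add] at h1
    have ht := ne_top_of_le_ne_top (EReal.coe_ne_top _) h1
    obtain ⟨e, he⟩ : ∃ e : ℝ, F ((1 - t) • j + t • p) = e :=
      ⟨_, (EReal.coe_toReal ht hb).symm⟩
    rw [he, EReal.coe_le_coe_iff] at h1
    rw [he, hd, ← EReal.coe_mul, ← EReal.coe_mul, ← EReal.coe_add, ← EReal.coe_add,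
      EReal.coe_le_coe_iff] at h2
    have h3 : (1 - t) • j + t • p - w = (j - w) + t • (p - j) := by module
    rw [h3, norm_add_sq_real, norm_smul, real_inner_smul_right, mul_pow, Real.norm_eq_abs,
      sq_abs] at h2
    have h4 := mul_le_mul_of_nonneg_left h1 hγ.le
    have h5 : t * (γ * d) ≤
        t * (γ * c + ⟪j - w, p - j⟫ + t * (‖p - j‖ ^ 2 / 2)) := by linarith
    exact le_of_mul_le_mul_left h5 ht0
  have hlim : γ * d ≤ γ * c + ⟪j - w, p - j⟫ := by
    have ht : Tendsto (fun t : ℝ => γ * c + ⟪j - w, p - j⟫ + t * (‖p - j‖ ^ 2 / 2)) (𝓝[>] 0)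
        (𝓝 (γ * c + ⟪j - w, p - j⟫ + 0 * (‖p - j‖ ^ 2 / 2))) :=
      tendsto_nhdsWithin_of_tendsto_nhds (Continuous.tendsto (by fun_prop) 0)
    rw [zero_mul, add_zero] at ht
    refine ge_of_tendsto ht ?_
    filter_upwards [Ioc_mem_nhdsGT (zero_lt_one' ℝ)] with t ht using main t ht
  have h6 := mul_le_mul_of_nonneg_left hsj hγ.le
  have h7 : ⟪w - j - γ • s, j - p⟫ = ⟪j - w, p - j⟫ - γ * ⟪s, j - p⟫ := by
    rw [inner_sub_left, real_inner_smul_left, ← neg_sub j w, ← neg_sub p j, inner_neg_neg]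
  rw [h7]
  linarith

/-- A convex differentiable function lies above its tangents. -/
theorem HasGradientAt.le_of_convexOn {E : Type*} [NormedAddCommGroup E] [InnerProductSpace ℝ E]
    [CompleteSpace E] {h : E → ℝ} (hc : ConvexOn ℝ Set.univ h) {x y v : E}
    (hv : HasGradientAt h v x) : h x + ⟪v, y - x⟫ ≤ h y := by
  have hline : HasDerivAt (fun t : ℝ => x + t • (y - x)) (y - x) 0 := by
    simpa using ((hasDerivAt_id (0 : ℝ)).smul_const (y - x)).const_add x
  have hd : HasDerivAt (fun t : ℝ => h (x + t • (y - x))) ⟪v, y - x⟫ 0 := by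
    have h0 : HasGradientAt h v (x + (0 : ℝ) • (y - x)) := by simpa using hv
    simpa [Function.comp_def] using h0.hasFDerivAt.comp_hasDerivAt (0 : ℝ) hline
  have hcc : ConvexOn ℝ Set.univ (fun t : ℝ => h (x + t • (y - x))) := by
    refine ⟨convex_univ, fun s _ t _ a b ha hb hab => ?_⟩
    have := hc.2 (Set.mem_univ (x + s • (y - x))) (Set.mem_univ (x + t • (y - x))) ha hb hab
    convert this using 2
    rw [show x + (a • s + b • t) • (y - x) = (1 : ℝ) • x + (a • s + b • t) • (y - x) by simp,
      ← hab]
    simp only [smul_eq_mul]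
    module
  have := hcc.le_slope_of_hasDerivAt (Set.mem_univ 0) (Set.mem_univ 1) zero_lt_one hd
  simp [slope_def_field] at this
  linarith

/-- The descent lemma. -/
theorem le_add_inner_add_of_lipschitz_gradient {E : Type*} [NormedAddCommGroup E]
    [InnerProductSpace ℝ E] [CompleteSpace E] {h : E → ℝ} {h' : E → E} {μ : ℝ}
    (hgrad : ∀ x, HasGradientAt h (h' x) x) (hlip : ∀ x y, ‖h' x - h' y‖ ≤ μ * ‖x - y‖)
    (x y : E) : h y ≤ h x + ⟪h' x, y - x⟫ + μ / 2 * ‖y - x‖ ^ 2 := by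
  have hd : ∀ t : ℝ, HasDerivAt
      (fun t : ℝ => h (x + t • (y - x)) - t * ⟪h' x, y - x⟫ - t ^ 2 * (μ / 2 * ‖y - x‖ ^ 2))
      (⟪h' (x + t • (y - x)), y - x⟫ - ⟪h' x, y - x⟫ - 2 * t * (μ / 2 * ‖y - x‖ ^ 2)) t := by
    intro t
    have hline : HasDerivAt (fun t : ℝ => x + t • (y - x)) (y - x) t := by
      simpa using ((hasDerivAt_id t).smul_const (y - x)).const_add x
    have h1 : HasDerivAt (fun t : ℝ => h (x + t • (y - x))) ⟪h' (x + t • (y - x)), y - x⟫ t := by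
      simpa [Function.comp_def] using (hgrad (x + t • (y - x))).hasFDerivAt.comp_hasDerivAt t hline
    have h2 : HasDerivAt (fun t : ℝ => t * ⟪h' x, y - x⟫) ⟪h' x, y - x⟫ t := by
      simpa using (hasDerivAt_id t).mul_const ⟪h' x, y - x⟫
    have h3 : HasDerivAt (fun t : ℝ => t ^ 2 * (μ / 2 * ‖y - x‖ ^ 2))
        (2 * t * (μ / 2 * ‖y - x‖ ^ 2)) t := by
      simpa using (hasDerivAt_pow 2 t).mul_const (μ / 2 * ‖y - x‖ ^ 2)
    exact (h1.sub h2).sub h3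
  have hanti : AntitoneOn
      (fun t : ℝ => h (x + t • (y - x)) - t * ⟪h' x, y - x⟫ - t ^ 2 * (μ / 2 * ‖y - x‖ ^ 2))
      (Set.Ici 0) := by
    refine antitoneOn_of_deriv_nonpos (convex_Ici 0)
      (fun t _ => (hd t).continuousAt.continuousWithinAt)
      (fun t _ => (hd t).differentiableAt.differentiableWithinAt) fun t ht => ?_
    rw [interior_Ici, Set.mem_Ioi] at ht
    rw [(hd t).deriv, ← inner_sub_left]
    have h1 := real_inner_le_norm (h' (x + t • (y - x)) - h' x) (y - x)
    have h2 := mul_le_mul_of_nonneg_right (hlip (x + t • (y - x)) x) (norm_nonneg (y - x))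
    rw [add_sub_cancel_left, norm_smul, Real.norm_eq_abs, abs_of_pos ht] at h2
    linarith
  have := hanti (Set.mem_Ici.2 le_rfl) (Set.mem_Ici.2 zero_le_one) zero_le_one
  simp at this
  linarith

/-- The Baillon–Haddad theorem: Lipschitz gradients of convex functions are cocoercive. -/
theorem norm_sub_sq_le_of_convexOn_of_lipschitz_gradient {E : Type*} [NormedAddCommGroup E]
    [InnerProductSpace ℝ E] [CompleteSpace E] {h : E → ℝ} {h' : E → E} {μ : ℝ} (hμ : 0 < μ)
    (hc : ConvexOn ℝ Set.univ h) (hgrad : ∀ x, HasGradientAt h (h' x) x)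
    (hlip : ∀ x y, ‖h' x - h' y‖ ≤ μ * ‖x - y‖) (x y : E) :
    μ⁻¹ * ‖h' x - h' y‖ ^ 2 ≤ ⟪h' x - h' y, x - y⟫ := by
  have key : ∀ x y : E,
      h x + ⟪h' x, y - x⟫ + (2 * μ)⁻¹ * ‖h' x - h' y‖ ^ 2 ≤ h y := by
    intro x y
    set w := y + μ⁻¹ • (h' x - h' y) with hw
    have h1 := (hgrad x).le_of_convexOn hc (y := w)
    have h2 := le_add_inner_add_of_lipschitz_gradient hgrad hlip y w
    have e1 : w - y = μ⁻¹ • (h' x - h' y) := by rw [hw]; abel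
    have e2 : w - x = (y - x) + μ⁻¹ • (h' x - h' y) := by rw [hw]; abel
    rw [e1, norm_smul, real_inner_smul_right, mul_pow, Real.norm_eq_abs, sq_abs] at h2
    rw [e2, inner_add_right, real_inner_smul_right] at h1
    have e3 : ⟪h' x, h' x - h' y⟫ - ⟪h' y, h' x - h' y⟫ = ‖h' x - h' y‖ ^ 2 := by
      rw [← inner_sub_left, real_inner_self_eq_norm_sq]
    have e4 : μ / 2 * (μ⁻¹ ^ 2 * ‖h' x - h' y‖ ^ 2) = (2 * μ)⁻¹ * ‖h' x - h' y‖ ^ 2 := by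
      field_simp
    have e5 : μ⁻¹ * ‖h' x - h' y‖ ^ 2 = 2 * ((2 * μ)⁻¹ * ‖h' x - h' y‖ ^ 2) := by
      field_simp
    have e6 := congrArg (μ⁻¹ * ·) e3
    simp only [mul_sub] at e6
    linarith
  have h1 := key x y
  have h2 := key y x
  rw [norm_sub_rev] at h2
  have e5 : μ⁻¹ * ‖h' x - h' y‖ ^ 2 = 2 * ((2 * μ)⁻¹ * ‖h' x - h' y‖ ^ 2) := by
    field_simp
  have e6 : ⟪h' x - h' y, x - y⟫ = - ⟪h' x, y - x⟫ - ⟪h' y, x - y⟫ := by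
    rw [inner_sub_left, ← neg_sub y x, inner_neg_right, inner_neg_right]
  linarith

/-- A quasi-Fejér recursion with relaxation and summable errors. -/
theorem quasi_fejer {a b d η lam : ℕ → ℝ} {c ε : ℝ} (hc : 0 < c) (hε : 0 < ε)
    (hlam : ∀ n, lam n ∈ Set.Icc ε 1) (ha : ∀ n, 0 ≤ a n) (hη0 : ∀ n, 0 ≤ η n) (hη : Summable η)
    (hstep : ∀ n, a (n + 1) ≤ (1 - lam n) * a n + lam n * b n + η n)
    (hdec : ∀ n, b n ^ 2 + c * d n ^ 2 ≤ a n ^ 2) :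
    (∃ R, ∀ n, a n ≤ R) ∧ Tendsto d atTop (𝓝 0) := by
  have hba : ∀ n, b n ≤ a n := fun n =>
    abs_le_of_sq_le_sq' (by nlinarith [hdec n, sq_nonneg (d n)]) (ha n) |>.2
  have hmul : ∀ n, ε * (a n - b n) ≤ a n - a (n + 1) + η n := fun n => by
    nlinarith [hstep n, hba n, (hlam n).1]
  have hsum : ∀ n, a n + ∑ k ∈ Finset.range n, ε * (a k - b k) ≤
      a 0 + ∑ k ∈ Finset.range n, η k := by
    intro n
    induction n with
    | zero => simp
    | succ n ih => rw [Finset.sum_range_succ, Finset.sum_range_succ]; linarith [hmul n]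
  have hpos : ∀ n, 0 ≤ ε * (a n - b n) := fun n =>
    mul_nonneg hε.le (sub_nonneg.2 (hba n))
  have hR : ∀ n, a n + ∑ k ∈ Finset.range n, ε * (a k - b k) ≤ a 0 + ∑' k, η k := fun n =>
    (hsum n).trans (by gcongr; exact hη.sum_le_tsum _ fun k _ => hη0 k)
  have haR : ∀ n, a n ≤ a 0 + ∑' k, η k := fun n => by
    have := Finset.sum_nonneg fun k (_ : k ∈ Finset.range n) => hpos k
    linarith [hR n]
  refine ⟨⟨_, haR⟩, ?_⟩
  set R := a 0 + ∑' k, η k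
  have hs : Summable fun n => ε * (a n - b n) :=
    summable_of_sum_range_le (c := R) hpos fun n => by linarith [hR n, ha n]
  have h0 := hs.tendsto_atTop_zero.const_mul (2 * R / (ε * c))
  rw [mul_zero] at h0
  have hd2 : Tendsto (fun n => d n ^ 2) atTop (𝓝 0) := by
    refine squeeze_zero (fun n => sq_nonneg _) (fun n => ?_) h0
    have e : 2 * R / (ε * c) * (ε * (a n - b n)) = 2 * R * (a n - b n) / c := by
      field_simp
    rw [e, le_div_iff₀ hc]
    nlinarith [hdec n, haR n, hba n]
  have := hd2.sqrt
  simp only [Real.sqrt_sq_eq_abs, Real.sqrt_zero] at this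
  exact (tendsto_zero_iff_abs_tendsto_zero d).2 this

theorem LinearMap.BilinForm.sqrt_apply_add_le {E : Type*} [AddCommGroup E] [Module ℝ E]
    (B : LinearMap.BilinForm ℝ E) (hs : ∀ u, 0 ≤ B u u) (hB : ∀ u v, B u v = B v u)
    (u v : E) :
    √(B (u + v) (u + v)) ≤ √(B u u) + √(B v v) := by
  refine Real.sqrt_le_iff.2 ⟨by positivity, ?_⟩
  have h1 : B u v ≤ √(B u u) * √(B v v) := by
    rw [← Real.sqrt_mul (hs u)]
    exact Real.le_sqrt_of_sq_le (LinearMap.BilinForm.apply_sq_le_of_symm B hs ⟨hB⟩ u v)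
  have h3 : B (u + v) (u + v) = B u u + 2 * B u v + B v v := by
    simp only [map_add, LinearMap.add_apply, hB v u]
    ring
  rw [h3, add_sq, Real.sq_sqrt (hs u), Real.sq_sqrt (hs v)]
  linarith

theorem LinearMap.BilinForm.sqrt_apply_smul {E : Type*} [AddCommGroup E] [Module ℝ E]
    (B : LinearMap.BilinForm ℝ E) {c : ℝ} (hc : 0 ≤ c) (u : E) :
    √(B (c • u) (c • u)) = c * √(B u u) := by
  simp only [map_smul, LinearMap.smul_apply, smul_eq_mul]
  rw [← mul_assoc, Real.sqrt_mul (mul_self_nonneg c), Real.sqrt_mul_self hc]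

theorem summable_norm_add {E : Type*} [NormedAddCommGroup E] {a b : ℕ → E} (ha : Summable fun n => ‖a n‖)
    (hb : Summable fun n => ‖b n‖) : Summable fun n => ‖a n + b n‖ :=
  (ha.add hb).of_nonneg_of_le (fun _ => norm_nonneg _) fun _ => norm_add_le _ _

theorem summable_norm_sub {E : Type*} [NormedAddCommGroup E] {a b : ℕ → E} (ha : Summable fun n => ‖a n‖)
    (hb : Summable fun n => ‖b n‖) : Summable fun n => ‖a n - b n‖ :=
  (ha.add hb).of_nonneg_of_le (fun _ => norm_nonneg _) fun _ => norm_sub_le _ _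

theorem summable_norm_smul {E : Type*} [NormedAddCommGroup E] [NormedSpace ℝ E]
    {a : ℕ → E} (c : ℝ) (ha : Summable fun n => ‖a n‖) :
    Summable fun n => ‖c • a n‖ := by
  simpa only [norm_smul] using ha.mul_left ‖c‖

theorem summable_norm_map {E F : Type*} [NormedAddCommGroup E] [NormedSpace ℝ E]
    [NormedAddCommGroup F] [NormedSpace ℝ F] (T : E →L[ℝ] F) {a : ℕ → E} (ha : Summable fun n => ‖a n‖) :
    Summable fun n => ‖T (a n)‖ :=
  (ha.mul_left ‖T‖).of_nonneg_of_le (fun _ => norm_nonneg _) fun _ => T.le_opNorm _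

theorem summable_norm_prodMk {E F : Type*} [NormedAddCommGroup E]
    [NormedAddCommGroup F] {a : ℕ → E} {b : ℕ → F} (ha : Summable fun n => ‖a n‖)
    (hb : Summable fun n => ‖b n‖) : Summable fun n => ‖(a n, b n)‖ :=
  (ha.add hb).of_nonneg_of_le (fun _ => norm_nonneg _) fun _ =>
    max_le_add_of_nonneg (norm_nonneg _) (norm_nonneg _)

theorem summable_norm_pi {ι : Type*} [Fintype ι] {E : ι → Type*}
    [∀ i, NormedAddCommGroup (E i)] {a : ℕ → ∀ i, E i}
    (ha : ∀ i, Summable fun n => ‖a n i‖) : Summable fun n => ‖a n‖ :=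
  (summable_sum fun i (_ : i ∈ Finset.univ) => ha i).of_nonneg_of_le
    (fun _ => norm_nonneg _) fun n => (pi_norm_le_iff_of_nonneg
      (Finset.sum_nonneg fun _ _ => norm_nonneg _)).2 fun i =>
        Finset.single_le_sum (f := fun i => ‖a n i‖) (fun _ _ => norm_nonneg _)
          (Finset.mem_univ i)

/-- The explicit formulas for the `z`, `y`, `v` updates solve an implicit linear system, up to
summable errors. -/
theorem exists_implicit_step {H X Y G : Type*} [NormedAddCommGroup H] [NormedSpace ℝ H]
    [NormedAddCommGroup X] [NormedSpace ℝ X] [NormedAddCommGroup Y] [NormedSpace ℝ Y]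
    [NormedAddCommGroup G] [NormedSpace ℝ G] (L : H →L[ℝ] G) (A : X →L[ℝ] G) (B : Y →L[ℝ] G)
    (r : G) {γ1 γ2 σ : ℝ} (hγ1 : 0 < γ1) (hγ2 : 0 < γ2) (hσ : 0 < σ)
    {x xt xj : ℕ → H} {p pt pj : ℕ → X} {q qt qj : ℕ → Y} {zz zt y yt v vt u1 u2 : ℕ → G}
    (hxj : Summable fun n => ‖xt n - xj n‖) (hpj : Summable fun n => ‖pt n - pj n‖)
    (hqj : Summable fun n => ‖qt n - qj n‖)
    (hu1 : Summable fun n => ‖u1 n - (zz n + γ1 • (A (p n - (2 : ℝ) • pt n) + v n +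
      σ • (L ((2 : ℝ) • xt n - x n) - r)))‖)
    (hu2 : Summable fun n => ‖u2 n - (y n + γ2 • (B (q n - (2 : ℝ) • qt n) + v n +
      σ • (L ((2 : ℝ) • xt n - x n) - r)))‖)
    (hzt : Summable fun n => ‖zt n - ((1 + σ * γ2) / (1 + σ * (γ1 + γ2))) •
      (u1 n - (σ * γ1 / (1 + σ * γ2)) • u2 n)‖)
    (hyt : Summable fun n => ‖yt n - (1 / (1 + σ * γ2)) • (u2 n - (σ * γ2) • zt n)‖)
    (hvt : Summable fun n =>
      ‖vt n - (v n + σ • (L ((2 : ℝ) • xt n - x n) - r - zt n - yt n))‖) :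
    ∃ zj yj vj : ℕ → G,
      (∀ n, zj n = zz n + γ1 • (A (p n - (2 : ℝ) • pj n) + vj n)) ∧
      (∀ n, yj n = y n + γ2 • (B (q n - (2 : ℝ) • qj n) + vj n)) ∧
      (∀ n, vj n = v n + σ • (L ((2 : ℝ) • xj n - x n) - r - zj n - yj n)) ∧
      (Summable fun n => ‖zt n - zj n‖) ∧ (Summable fun n => ‖yt n - yj n‖) ∧
      (Summable fun n => ‖vt n - vj n‖) := by
  have h1 : (1 + σ * γ2) ≠ 0 := by positivity
  have h2 : (1 + σ * (γ1 + γ2)) ≠ 0 := by positivity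
  set w1 : ℕ → G := fun n => zz n + γ1 • (A (p n - (2 : ℝ) • pj n) + v n +
    σ • (L ((2 : ℝ) • xj n - x n) - r)) with hw1
  set w2 : ℕ → G := fun n => y n + γ2 • (B (q n - (2 : ℝ) • qj n) + v n +
    σ • (L ((2 : ℝ) • xj n - x n) - r)) with hw2
  set zj : ℕ → G := fun n => ((1 + σ * γ2) / (1 + σ * (γ1 + γ2))) •
    (w1 n - (σ * γ1 / (1 + σ * γ2)) • w2 n) with hzj
  set yj : ℕ → G := fun n => (1 / (1 + σ * γ2)) • (w2 n - (σ * γ2) • zj n) with hyj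
  have sL := summable_norm_smul 2 (summable_norm_map L hxj)
  have s1 : Summable fun n => ‖u1 n - w1 n‖ := by
    convert summable_norm_add hu1 (summable_norm_smul γ1 (summable_norm_sub
      (summable_norm_smul σ sL) (summable_norm_smul 2 (summable_norm_map A hpj)))) using 3
    simp only [hw1, map_sub, map_smul]
    module
  have s2 : Summable fun n => ‖u2 n - w2 n‖ := by
    convert summable_norm_add hu2 (summable_norm_smul γ2 (summable_norm_sub
      (summable_norm_smul σ sL) (summable_norm_smul 2 (summable_norm_map B hqj)))) using 3
    simp only [hw2, map_sub, map_smul]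
    module
  have sz : Summable fun n => ‖zt n - zj n‖ := by
    convert summable_norm_add hzt (summable_norm_smul ((1 + σ * γ2) / (1 + σ * (γ1 + γ2)))
      (summable_norm_sub s1 (summable_norm_smul (σ * γ1 / (1 + σ * γ2)) s2))) using 3
    simp only [hzj]
    module
  have sy : Summable fun n => ‖yt n - yj n‖ := by
    convert summable_norm_add hyt (summable_norm_smul (1 / (1 + σ * γ2))
      (summable_norm_sub s2 (summable_norm_smul (σ * γ2) sz))) using 3
    simp only [hyj]
    module
  refine ⟨zj, yj, fun n => v n + σ • (L ((2 : ℝ) • xj n - x n) - r - zj n - yj n),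
    fun n => ?_, fun n => ?_, fun n => rfl, sz, sy, ?_⟩
  · have e1 : w1 n = zj n + (σ * γ1) • (zj n + yj n) := by
      simp only [hyj, hzj]
      match_scalars <;> field_simp <;> ring
    have e2 : zj n = w1 n - (σ * γ1) • (zj n + yj n) := eq_sub_of_add_eq e1.symm
    rw [e2.trans (by rfl)]
    nth_rewrite 1 [hw1]
    module
  · have e1 : w2 n = yj n + (σ * γ2) • (zj n + yj n) := by
      simp only [hyj]
      match_scalars <;> field_simp <;> ring
    have e2 : yj n = w2 n - (σ * γ2) • (zj n + yj n) := eq_sub_of_add_eq e1.symm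
    refine e2.trans ?_
    nth_rewrite 1 [hw2]
    module
  · convert summable_norm_add hvt (summable_norm_smul σ
      (summable_norm_sub (summable_norm_sub sL sz) sy)) using 3
    simp only [map_sub, map_smul]
    module

theorem abs_two_mul_inner_map_le {E F : Type*} [NormedAddCommGroup E] [InnerProductSpace ℝ E]
    [NormedAddCommGroup F] [InnerProductSpace ℝ F] (T : E →L[ℝ] F) (x : E) (y : F) {α b : ℝ}
    (hα : 0 < α) (hb : 0 < b) :
    |2 * ⟪T x, y⟫| ≤ α * (b⁻¹ * ‖y‖ ^ 2) + α⁻¹ * (b * ‖T‖ ^ 2) * ‖x‖ ^ 2 := by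
  rw [abs_mul, abs_two]
  have h1 : |⟪T x, y⟫| ≤ ‖T‖ * ‖x‖ * ‖y‖ :=
    (abs_real_inner_le_norm _ _).trans (by gcongr; exact T.le_opNorm x)
  have h2 : α * (b⁻¹ * ‖y‖ ^ 2) + α⁻¹ * (b * ‖T‖ ^ 2) * ‖x‖ ^ 2 - 2 * (‖T‖ * ‖x‖ * ‖y‖) =
      (α * ‖y‖ - b * (‖T‖ * ‖x‖)) ^ 2 / (α * b) := by
    field_simp
    ring
  have h3 : 0 ≤ (α * ‖y‖ - b * (‖T‖ * ‖x‖)) ^ 2 / (α * b) := by positivity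
  linarith

theorem abs_two_mul_inner_map_le_of_mul_le {E F : Type*} [NormedAddCommGroup E]
    [InnerProductSpace ℝ E] [NormedAddCommGroup F] [InnerProductSpace ℝ F] (T : E →L[ℝ] F)
    (x : E) (y : F) {α a b : ℝ} (hα : 0 < α) (ha : 0 < a) (hb : 0 < b)
    (h : b * a * ‖T‖ ^ 2 ≤ α ^ 2) :
    |2 * ⟪T x, y⟫| ≤ α * (b⁻¹ * ‖y‖ ^ 2 + a⁻¹ * ‖x‖ ^ 2) := by
  have h1 := abs_two_mul_inner_map_le T x y hα hb
  have h2 : α⁻¹ * (b * ‖T‖ ^ 2) ≤ α * a⁻¹ := by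
    have e1 : α⁻¹ * (b * ‖T‖ ^ 2) = b * a * ‖T‖ ^ 2 / (α * a) := by field_simp
    have e2 : α * a⁻¹ = α ^ 2 / (α * a) := by field_simp
    rw [e1, e2]
    gcongr
  nlinarith [mul_le_mul_of_nonneg_right h2 (sq_nonneg ‖x‖)]

section Block

variable {H X Y G : Type*} [NormedAddCommGroup H] [InnerProductSpace ℝ H]
  [NormedAddCommGroup X] [InnerProductSpace ℝ X]
  [NormedAddCommGroup Y] [InnerProductSpace ℝ Y]
  [NormedAddCommGroup G] [InnerProductSpace ℝ G]

/-- The contribution of one index `i` to the bilinear form of the variable metric, the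
coordinates being ordered as `(x, p, q, z, y, v)`. -/
def blockForm (θ1 θ2 γ1 γ2 σ : ℝ) (L : H →L[ℝ] G) (K : G →L[ℝ] X) (M : G →L[ℝ] Y) :
    LinearMap.BilinForm ℝ (H × X × Y × G × G × G) :=
  LinearMap.mk₂ ℝ (fun ⟨x, p, q, z, y, v⟩ ⟨x', p', q', z', y', v'⟩ =>
      θ1⁻¹ * ⟪p, p'⟫ + θ2⁻¹ * ⟪q, q'⟫ + γ1⁻¹ * ⟪z, z'⟫ + γ2⁻¹ * ⟪y, y'⟫ + σ⁻¹ * ⟪v, v'⟫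
        - (⟪L x, v'⟫ + ⟪L x', v⟫) + (⟪K z, p'⟫ + ⟪K z', p⟫) + (⟪M y, q'⟫ + ⟪M y', q⟫))
    (by
      rintro ⟨x, p, q, z, y, v⟩ ⟨x', p', q', z', y', v'⟩ ⟨x'', p'', q'', z'', y'', v''⟩
      simp only [inner_add_left, inner_add_right, map_add]
      ring)
    (by
      rintro c ⟨x, p, q, z, y, v⟩ ⟨x', p', q', z', y', v'⟩
      simp only [Prod.smul_mk, real_inner_smul_left, real_inner_smul_right, map_smul, smul_eq_mul]
      ring)
    (by
      rintro ⟨x, p, q, z, y, v⟩ ⟨x', p', q', z', y', v'⟩ ⟨x'', p'', q'', z'', y'', v''⟩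
      simp only [inner_add_left, inner_add_right, map_add]
      ring)
    (by
      rintro c ⟨x, p, q, z, y, v⟩ ⟨x', p', q', z', y', v'⟩
      simp only [Prod.smul_mk, real_inner_smul_left, real_inner_smul_right, map_smul, smul_eq_mul]
      ring)

theorem blockForm_apply (θ1 θ2 γ1 γ2 σ : ℝ) (L : H →L[ℝ] G) (K : G →L[ℝ] X) (M : G →L[ℝ] Y)
    (x x' : H) (p p' : X) (q q' : Y) (z z' y y' v v' : G) :
    blockForm θ1 θ2 γ1 γ2 σ L K M (x, p, q, z, y, v) (x', p', q', z', y', v') =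
      θ1⁻¹ * ⟪p, p'⟫ + θ2⁻¹ * ⟪q, q'⟫ + γ1⁻¹ * ⟪z, z'⟫ + γ2⁻¹ * ⟪y, y'⟫ + σ⁻¹ * ⟪v, v'⟫
        - (⟪L x, v'⟫ + ⟪L x', v⟫) + (⟪K z, p'⟫ + ⟪K z', p⟫) + (⟪M y, q'⟫ + ⟪M y', q⟫) :=
  rfl

theorem blockForm_comm (θ1 θ2 γ1 γ2 σ : ℝ) (L : H →L[ℝ] G) (K : G →L[ℝ] X) (M : G →L[ℝ] Y)
    (u w : H × X × Y × G × G × G) :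
    blockForm θ1 θ2 γ1 γ2 σ L K M u w = blockForm θ1 θ2 γ1 γ2 σ L K M w u := by
  obtain ⟨x, p, q, z, y, v⟩ := u
  obtain ⟨x', p', q', z', y', v'⟩ := w
  rw [blockForm_apply, blockForm_apply, real_inner_comm p p', real_inner_comm q q',
    real_inner_comm z z', real_inner_comm y y', real_inner_comm v v']
  ring

theorem abs_blockForm_self_sub_le {θ1 θ2 γ1 γ2 σ α : ℝ} (hθ1 : 0 < θ1) (hθ2 : 0 < θ2)
    (hγ1 : 0 < γ1) (hγ2 : 0 < γ2) (hσ : 0 < σ) (hα : 0 < α) (L : H →L[ℝ] G) (K : G →L[ℝ] X)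
    (M : G →L[ℝ] Y) (hK : θ1 * γ1 * ‖K‖ ^ 2 ≤ α ^ 2) (hM : θ2 * γ2 * ‖M‖ ^ 2 ≤ α ^ 2)
    (x : H) (p : X) (q : Y) (z y v : G) :
    |blockForm θ1 θ2 γ1 γ2 σ L K M (x, p, q, z, y, v) (x, p, q, z, y, v) -
        (θ1⁻¹ * ‖p‖ ^ 2 + θ2⁻¹ * ‖q‖ ^ 2 + γ1⁻¹ * ‖z‖ ^ 2 + γ2⁻¹ * ‖y‖ ^ 2 + σ⁻¹ * ‖v‖ ^ 2)| ≤
      α * (θ1⁻¹ * ‖p‖ ^ 2 + θ2⁻¹ * ‖q‖ ^ 2 + γ1⁻¹ * ‖z‖ ^ 2 + γ2⁻¹ * ‖y‖ ^ 2 +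
        σ⁻¹ * ‖v‖ ^ 2) + α⁻¹ * (σ * ‖L‖ ^ 2) * ‖x‖ ^ 2 := by
  have h1 := abs_le.1 (abs_two_mul_inner_map_le L x v hα hσ)
  have h2 := abs_le.1 (abs_two_mul_inner_map_le_of_mul_le K z p hα hγ1 hθ1 hK)
  have h3 := abs_le.1 (abs_two_mul_inner_map_le_of_mul_le M y q hα hγ2 hθ2 hM)
  rw [blockForm_apply, abs_le]
  simp only [real_inner_self_eq_norm_sq]
  constructor <;> linarith [h1.1, h1.2, h2.1, h2.2, h3.1, h3.2]

/-- One index of the exact primal-dual step: `d` is the distance of the new iterate to a solution,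
`e` the difference between the old iterate and the new one. -/
theorem neg_inner_le_blockForm [CompleteSpace X] [CompleteSpace Y] [CompleteSpace G]
    {θ1 θ2 γ1 γ2 σ : ℝ} (hθ1 : 0 < θ1) (hθ2 : 0 < θ2)
    (hγ1 : 0 < γ1) (hγ2 : 0 < γ2) (hσ : 0 < σ) (L : H →L[ℝ] G) (K : G →L[ℝ] X)
    (M : G →L[ℝ] Y) {dx ex : H} {dp ep : X} {dq eq : Y} {dz ez dy ey dv ev : G}
    (hp : 0 ≤ ⟪ep + θ1 • K (dz + ez), dp⟫) (hq : 0 ≤ ⟪eq + θ2 • M (dy + ey), dq⟫)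
    (hz : ez + γ1 • (K.adjoint (ep - dp) + dv) = 0)
    (hy : ey + γ2 • (M.adjoint (eq - dq) + dv) = 0)
    (hv : ev + σ • (L (dx - ex) - dz - dy) = 0) :
    -⟪L dx, dv + ev⟫ ≤
      blockForm θ1 θ2 γ1 γ2 σ L K M (dx, dp, dq, dz, dy, dv) (ex, ep, eq, ez, ey, ev) := by
  have hp' : 0 ≤ θ1⁻¹ * ⟪dp, ep⟫ + ⟪K dz, dp⟫ + ⟪K ez, dp⟫ := by
    have := mul_nonneg (inv_nonneg.2 hθ1.le) hp
    rw [inner_add_left, real_inner_smul_left, mul_add, inv_mul_cancel_left₀ hθ1.ne', map_add,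
      inner_add_left, real_inner_comm] at this
    linarith
  have hq' : 0 ≤ θ2⁻¹ * ⟪dq, eq⟫ + ⟪M dy, dq⟫ + ⟪M ey, dq⟫ := by
    have := mul_nonneg (inv_nonneg.2 hθ2.le) hq
    rw [inner_add_left, real_inner_smul_left, mul_add, inv_mul_cancel_left₀ hθ2.ne', map_add,
      inner_add_left, real_inner_comm] at this
    linarith
  have hz' : γ1⁻¹ * ⟪dz, ez⟫ = - (⟪K dz, ep⟫ - ⟪K dz, dp⟫ + ⟪dz, dv⟫) := by
    rw [eq_neg_of_add_eq_zero_left hz, inner_neg_right, real_inner_smul_right, mul_neg,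
      inv_mul_cancel_left₀ hγ1.ne', inner_add_right, ContinuousLinearMap.adjoint_inner_right,
      inner_sub_right]
  have hy' : γ2⁻¹ * ⟪dy, ey⟫ = - (⟪M dy, eq⟫ - ⟪M dy, dq⟫ + ⟪dy, dv⟫) := by
    rw [eq_neg_of_add_eq_zero_left hy, inner_neg_right, real_inner_smul_right, mul_neg,
      inv_mul_cancel_left₀ hγ2.ne', inner_add_right, ContinuousLinearMap.adjoint_inner_right,
      inner_sub_right]
  have hv' : σ⁻¹ * ⟪dv, ev⟫ = - (⟪L dx, dv⟫ - ⟪L ex, dv⟫ - ⟪dz, dv⟫ - ⟪dy, dv⟫) := by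
    rw [eq_neg_of_add_eq_zero_left hv, inner_neg_right, real_inner_smul_right, mul_neg,
      inv_mul_cancel_left₀ hσ.ne', inner_sub_right, inner_sub_right, map_sub, inner_sub_right,
      real_inner_comm (L dx), real_inner_comm (L ex), real_inner_comm dz, real_inner_comm dy]
  rw [blockForm_apply, hz', hy', hv', inner_add_right]
  linarith

end Block

section Metric

variable {ι : Type*} [Fintype ι] {H : Type*} {X Y G : ι → Type*}
  [NormedAddCommGroup H] [InnerProductSpace ℝ H]
  [∀ i, NormedAddCommGroup (X i)] [∀ i, InnerProductSpace ℝ (X i)]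
  [∀ i, NormedAddCommGroup (Y i)] [∀ i, InnerProductSpace ℝ (Y i)]
  [∀ i, NormedAddCommGroup (G i)] [∀ i, InnerProductSpace ℝ (G i)]

/-- The bilinear form of the variable metric in which the primal-dual scheme is a
forward-backward iteration. -/
def metricForm (τ : ℝ) (θ1 θ2 γ1 γ2 σ : ι → ℝ) (L : ∀ i, H →L[ℝ] G i) (K : ∀ i, G i →L[ℝ] X i)
    (M : ∀ i, G i →L[ℝ] Y i) :
    LinearMap.BilinForm ℝ (H × ∀ i, X i × Y i × G i × G i × G i) :=
  LinearMap.mk₂ ℝ (fun u w => τ⁻¹ * ⟪u.1, w.1⟫ +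
      ∑ i, blockForm (θ1 i) (θ2 i) (γ1 i) (γ2 i) (σ i) (L i) (K i) (M i)
        (u.1, u.2 i) (w.1, w.2 i))
    (fun u u' w => by
      simp only [Prod.fst_add, Prod.snd_add, Pi.add_apply, ← Prod.mk_add_mk, map_add,
        LinearMap.add_apply, inner_add_left, Finset.sum_add_distrib]
      ring)
    (fun c u w => by
      simp only [Prod.smul_fst, Prod.smul_snd, Pi.smul_apply, ← Prod.smul_mk, map_smul,
        LinearMap.smul_apply, real_inner_smul_left, smul_eq_mul, ← Finset.mul_sum]
      ring)
    (fun u w w' => by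
      simp only [Prod.fst_add, Prod.snd_add, Pi.add_apply, ← Prod.mk_add_mk, map_add,
        inner_add_right, Finset.sum_add_distrib]
      ring)
    (fun c u w => by
      simp only [Prod.smul_fst, Prod.smul_snd, Pi.smul_apply, ← Prod.smul_mk, map_smul,
        real_inner_smul_right, smul_eq_mul, ← Finset.mul_sum]
      ring)

theorem metricForm_apply (τ : ℝ) (θ1 θ2 γ1 γ2 σ : ι → ℝ) (L : ∀ i, H →L[ℝ] G i)
    (K : ∀ i, G i →L[ℝ] X i) (M : ∀ i, G i →L[ℝ] Y i)
    (u w : H × ∀ i, X i × Y i × G i × G i × G i) :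
    metricForm τ θ1 θ2 γ1 γ2 σ L K M u w = τ⁻¹ * ⟪u.1, w.1⟫ +
      ∑ i, blockForm (θ1 i) (θ2 i) (γ1 i) (γ2 i) (σ i) (L i) (K i) (M i)
        (u.1, u.2 i) (w.1, w.2 i) :=
  rfl

theorem metricForm_comm (τ : ℝ) (θ1 θ2 γ1 γ2 σ : ι → ℝ) (L : ∀ i, H →L[ℝ] G i)
    (K : ∀ i, G i →L[ℝ] X i) (M : ∀ i, G i →L[ℝ] Y i)
    (u w : H × ∀ i, X i × Y i × G i × G i × G i) :
    metricForm τ θ1 θ2 γ1 γ2 σ L K M u w = metricForm τ θ1 θ2 γ1 γ2 σ L K M w u := by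
  simp only [metricForm_apply, real_inner_comm u.1 w.1, blockForm_comm _ _ _ _ _ _ _ _ (u.1, _)]

theorem le_metricForm_self {τ : ℝ} {θ1 θ2 γ1 γ2 σ : ι → ℝ} {α : ℝ} (hτ : 0 < τ)
    (hθ1 : ∀ i, 0 < θ1 i) (hθ2 : ∀ i, 0 < θ2 i) (hγ1 : ∀ i, 0 < γ1 i) (hγ2 : ∀ i, 0 < γ2 i)
    (hσ : ∀ i, 0 < σ i) (hα : 0 < α) (hα1 : α ≤ 1) (L : ∀ i, H →L[ℝ] G i)
    (K : ∀ i, G i →L[ℝ] X i) (M : ∀ i, G i →L[ℝ] Y i) (hL : τ * ∑ i, σ i * ‖L i‖ ^ 2 ≤ α ^ 2)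
    (hK : ∀ i, θ1 i * γ1 i * ‖K i‖ ^ 2 ≤ α ^ 2) (hM : ∀ i, θ2 i * γ2 i * ‖M i‖ ^ 2 ≤ α ^ 2)
    (u : H × ∀ i, X i × Y i × G i × G i × G i) :
    (1 - α) / τ * ‖u.1‖ ^ 2 ≤ metricForm τ θ1 θ2 γ1 γ2 σ L K M u u := by
  have h1 : ∀ i, -(α⁻¹ * (σ i * ‖L i‖ ^ 2) * ‖u.1‖ ^ 2) ≤
      blockForm (θ1 i) (θ2 i) (γ1 i) (γ2 i) (σ i) (L i) (K i) (M i) (u.1, u.2 i) (u.1, u.2 i) := by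
    intro i
    obtain ⟨p, q, z, y, v⟩ := u.2 i
    have := (abs_le.1 (abs_blockForm_self_sub_le (hθ1 i) (hθ2 i) (hγ1 i) (hγ2 i) (hσ i) hα
      (L i) (K i) (M i) (hK i) (hM i) u.1 p q z y v)).1
    have hθ1 := hθ1 i
    have hθ2 := hθ2 i
    have hγ1 := hγ1 i
    have hγ2 := hγ2 i
    have hσ := hσ i
    have h0 : 0 ≤ (1 - α) * ((θ1 i)⁻¹ * ‖p‖ ^ 2 + (θ2 i)⁻¹ * ‖q‖ ^ 2 + (γ1 i)⁻¹ * ‖z‖ ^ 2 +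
        (γ2 i)⁻¹ * ‖y‖ ^ 2 + (σ i)⁻¹ * ‖v‖ ^ 2) :=
      mul_nonneg (sub_nonneg.2 hα1) (by positivity)
    linarith
  have h2 := Finset.sum_le_sum fun i (_ : i ∈ Finset.univ) => h1 i
  rw [Finset.sum_neg_distrib, ← Finset.sum_mul, ← Finset.mul_sum] at h2
  have h3 : α⁻¹ * ∑ i, σ i * ‖L i‖ ^ 2 ≤ α / τ := by
    rw [inv_mul_le_iff₀ hα, ← mul_div_assoc, le_div_iff₀ hτ, ← sq]
    linarith
  have h4 := mul_le_mul_of_nonneg_right h3 (sq_nonneg ‖u.1‖)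
  rw [metricForm_apply, real_inner_self_eq_norm_sq]
  have h5 : (1 - α) / τ * ‖u.1‖ ^ 2 = τ⁻¹ * ‖u.1‖ ^ 2 - α / τ * ‖u.1‖ ^ 2 := by ring
  linarith

theorem exists_metricForm_self_le {τ : ℝ} {θ1 θ2 γ1 γ2 σ : ι → ℝ} {α : ℝ} (hτ : 0 < τ)
    (hθ1 : ∀ i, 0 < θ1 i) (hθ2 : ∀ i, 0 < θ2 i) (hγ1 : ∀ i, 0 < γ1 i) (hγ2 : ∀ i, 0 < γ2 i)
    (hσ : ∀ i, 0 < σ i) (hα : 0 < α) (L : ∀ i, H →L[ℝ] G i)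
    (K : ∀ i, G i →L[ℝ] X i) (M : ∀ i, G i →L[ℝ] Y i)
    (hK : ∀ i, θ1 i * γ1 i * ‖K i‖ ^ 2 ≤ α ^ 2) (hM : ∀ i, θ2 i * γ2 i * ‖M i‖ ^ 2 ≤ α ^ 2) :
    ∃ C, 0 ≤ C ∧ ∀ u : H × ∀ i, X i × Y i × G i × G i × G i,
      metricForm τ θ1 θ2 γ1 γ2 σ L K M u u ≤ C * ‖u‖ ^ 2 := by
  refine ⟨τ⁻¹ + ∑ i, ((1 + α) * ((θ1 i)⁻¹ + (θ2 i)⁻¹ + (γ1 i)⁻¹ + (γ2 i)⁻¹ + (σ i)⁻¹) +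
    α⁻¹ * (σ i * ‖L i‖ ^ 2)), ?_, fun u => ?_⟩
  · refine add_nonneg (inv_nonneg.2 hτ.le) (Finset.sum_nonneg fun i _ => ?_)
    have hθ1 := hθ1 i
    have hθ2 := hθ2 i
    have hγ1 := hγ1 i
    have hγ2 := hγ2 i
    have hσ := hσ i
    positivity
  · have hu1 : ‖u.1‖ ≤ ‖u‖ := norm_fst_le u
    rw [metricForm_apply, add_mul, Finset.sum_mul, real_inner_self_eq_norm_sq]
    refine add_le_add (by have := inv_nonneg.2 hτ.le; gcongr) (Finset.sum_le_sum fun i _ => ?_)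
    have hui : ‖u.2 i‖ ≤ ‖u‖ := (norm_le_pi_norm u.2 i).trans (norm_snd_le u)
    generalize u.2 i = w at hui ⊢
    obtain ⟨p, q, z, y, v⟩ := w
    simp only [Prod.norm_mk, sup_le_iff] at hui
    obtain ⟨hp, hq, hz, hy, hv⟩ := hui
    have := (abs_le.1 (abs_blockForm_self_sub_le (hθ1 i) (hθ2 i) (hγ1 i) (hγ2 i) (hσ i) hα
      (L i) (K i) (M i) (hK i) (hM i) u.1 p q z y v)).2
    have hθ1 := hθ1 i
    have hθ2 := hθ2 i
    have hγ1 := hγ1 i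
    have hγ2 := hγ2 i
    have hσ := hσ i
    calc _ ≤ (1 + α) * ((θ1 i)⁻¹ * ‖p‖ ^ 2 + (θ2 i)⁻¹ * ‖q‖ ^ 2 + (γ1 i)⁻¹ * ‖z‖ ^ 2 +
          (γ2 i)⁻¹ * ‖y‖ ^ 2 + (σ i)⁻¹ * ‖v‖ ^ 2) +
          α⁻¹ * (σ i * ‖L i‖ ^ 2) * ‖u.1‖ ^ 2 := by linarith
      _ ≤ (1 + α) * ((θ1 i)⁻¹ * ‖u‖ ^ 2 + (θ2 i)⁻¹ * ‖u‖ ^ 2 + (γ1 i)⁻¹ * ‖u‖ ^ 2 +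
          (γ2 i)⁻¹ * ‖u‖ ^ 2 + (σ i)⁻¹ * ‖u‖ ^ 2) +
          α⁻¹ * (σ i * ‖L i‖ ^ 2) * ‖u‖ ^ 2 := by gcongr
      _ = _ := by ring

theorem inner_le_metricForm [CompleteSpace H] [∀ i, CompleteSpace (X i)]
    [∀ i, CompleteSpace (Y i)] [∀ i, CompleteSpace (G i)] {τ : ℝ} {θ1 θ2 γ1 γ2 σ : ι → ℝ}
    (hτ : 0 < τ) (hθ1 : ∀ i, 0 < θ1 i) (hθ2 : ∀ i, 0 < θ2 i) (hγ1 : ∀ i, 0 < γ1 i)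
    (hγ2 : ∀ i, 0 < γ2 i) (hσ : ∀ i, 0 < σ i) (L : ∀ i, H →L[ℝ] G i)
    (K : ∀ i, G i →L[ℝ] X i) (M : ∀ i, G i →L[ℝ] Y i) {δ dx ex : H} {dp ep : ∀ i, X i}
    {dq eq : ∀ i, Y i} {dz ez dy ey dv ev : ∀ i, G i}
    (hx : 0 ≤ ⟪ex - τ • (δ + ∑ i, (L i).adjoint (dv i + ev i)), dx⟫)
    (hp : ∀ i, 0 ≤ ⟪ep i + θ1 i • K i (dz i + ez i), dp i⟫)
    (hq : ∀ i, 0 ≤ ⟪eq i + θ2 i • M i (dy i + ey i), dq i⟫)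
    (hz : ∀ i, ez i + γ1 i • ((K i).adjoint (ep i - dp i) + dv i) = 0)
    (hy : ∀ i, ey i + γ2 i • ((M i).adjoint (eq i - dq i) + dv i) = 0)
    (hv : ∀ i, ev i + σ i • (L i (dx - ex) - dz i - dy i) = 0) :
    ⟪δ, dx⟫ ≤ metricForm τ θ1 θ2 γ1 γ2 σ L K M
      (dx, fun i => (dp i, dq i, dz i, dy i, dv i))
      (ex, fun i => (ep i, eq i, ez i, ey i, ev i)) := by
  have h1 := Finset.sum_le_sum fun i (_ : i ∈ Finset.univ) =>
    neg_inner_le_blockForm (hθ1 i) (hθ2 i) (hγ1 i) (hγ2 i) (hσ i) (L i) (K i) (M i)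
      (hp i) (hq i) (hz i) (hy i) (hv i)
  have h2 := mul_nonneg (inv_nonneg.2 hτ.le) hx
  rw [inner_sub_left, real_inner_smul_left, mul_sub, inv_mul_cancel_left₀ hτ.ne', inner_add_left,
    sum_inner, real_inner_comm] at h2
  simp only [ContinuousLinearMap.adjoint_inner_left] at h2
  rw [Finset.sum_neg_distrib] at h1
  simp only [real_inner_comm (L _ dx)] at h1 h2
  rw [metricForm_apply]
  linarith

end Metric

/-- The decrease of a quadratic form in one forward-backward step with a cocoercive forward
part `δ`. -/
theorem forwardBackward_decrease {H E : Type*} [NormedAddCommGroup H] [InnerProductSpace ℝ H]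
    [AddCommGroup E] [Module ℝ E] (B : LinearMap.BilinForm ℝ (H × E))
    (hB : ∀ u w, B u w = B w u) {ρ μ : ℝ} (hρ : 0 < ρ)
    (hBρ : ∀ u, ρ * ‖u.1‖ ^ 2 ≤ B u u) {d e : H × E} {δ : H}
    (hδ : μ⁻¹ * ‖δ‖ ^ 2 ≤ ⟪δ, d.1 + e.1⟫) (h : ⟪δ, d.1⟫ ≤ B d e) :
    B d d + (2 * μ⁻¹ - ρ⁻¹) * ‖δ‖ ^ 2 ≤ B (d + e) (d + e) := by
  have h1 : B (d + e) (d + e) = B d d + 2 * B d e + B e e := by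
    simp only [map_add, LinearMap.add_apply, hB e d]
    ring
  have h2 := real_inner_le_norm δ e.1
  have h3 : ρ * ‖e.1‖ ^ 2 + ρ⁻¹ * ‖δ‖ ^ 2 - 2 * (‖δ‖ * ‖e.1‖) =
      ρ⁻¹ * (ρ * ‖e.1‖ - ‖δ‖) ^ 2 := by
    field_simp
    ring
  have h4 : 0 ≤ ρ⁻¹ * (ρ * ‖e.1‖ - ‖δ‖) ^ 2 := by positivity
  rw [inner_add_right] at hδ
  linarith [hBρ e]

/-- At a point of uniform convexity, convergence of the monotonicity gap of the gradient implies
strong convergence. -/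
theorem tendsto_of_tendsto_inner_gradient {E : Type*} [NormedAddCommGroup E]
    [InnerProductSpace ℝ E] [CompleteSpace E] {h : E → ℝ} {h' : E → E}
    (hc : ConvexOn ℝ Set.univ h) (hgrad : ∀ x, HasGradientAt h (h' x) x) {xb : E} {φ : ℝ → ℝ≥0∞}
    (hmono : MonotoneOn φ (Set.Ici 0)) (hφ : ∀ t : ℝ, 0 ≤ t → (φ t = 0 ↔ t = 0))
    (hunif : ∀ (x' : E) (lam : ℝ), lam ∈ Set.Ioo (0:ℝ) 1 →
      ((h (lam • x' + (1 - lam) • xb) : ℝ) : EReal) ≤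
        ((lam : ℝ) : EReal) * ((h x' : ℝ) : EReal) +
          ((1 - lam : ℝ) : EReal) * ((h xb : ℝ) : EReal) -
          ((lam * (1 - lam) : ℝ) : EReal) * (φ ‖x' - xb‖ : EReal))
    {x : ℕ → E} (hx : Tendsto (fun n => ⟪h' (x n) - h' xb, x n - xb⟫) atTop (𝓝 0)) :
    Tendsto x atTop (𝓝 xb) := by
  have key : ∀ x', φ ‖x' - xb‖ ≤ ENNReal.ofReal (2 * ⟪h' x' - h' xb, x' - xb⟫) := by
    intro x'
    have h1 := hunif x' (1 / 2) (by norm_num)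
    have h2 := (hgrad xb).le_of_convexOn hc (y := (1 / 2 : ℝ) • x' + (1 - 1 / 2 : ℝ) • xb)
    have h3 := (hgrad x').le_of_convexOn hc (y := xb)
    have e1 : (1 / 2 : ℝ) • x' + (1 - 1 / 2 : ℝ) • xb - xb = (1 / 2 : ℝ) • (x' - xb) := by module
    rw [e1, real_inner_smul_right] at h2
    rw [← neg_sub x' xb, inner_neg_right] at h3
    rw [← EReal.coe_mul, ← EReal.coe_mul, ← EReal.coe_add] at h1
    induction hφx : φ ‖x' - xb‖ with
    | top =>
      rw [hφx, EReal.coe_ennreal_top, EReal.coe_mul_top_of_pos (by norm_num), EReal.sub_top,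
        le_bot_iff] at h1
      exact absurd h1 (EReal.coe_ne_bot _)
    | coe t =>
      rw [hφx, EReal.coe_nnreal_eq_coe_real, ← EReal.coe_mul, ← EReal.coe_sub,
        EReal.coe_le_coe_iff] at h1
      rw [← ENNReal.ofReal_coe_nnreal]
      refine ENNReal.ofReal_le_ofReal ?_
      rw [inner_sub_left]
      linarith
  have hlim : Tendsto (fun n => φ ‖x n - xb‖) atTop (𝓝 0) := by
    have h1 := ENNReal.tendsto_ofReal (hx.const_mul 2)
    rw [mul_zero, ENNReal.ofReal_zero] at h1
    exact tendsto_of_tendsto_of_tendsto_of_le_of_le tendsto_const_nhds h1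
      (fun _ => zero_le) fun n => key (x n)
  refine Metric.tendsto_atTop'.2 fun r hr => ?_
  have hpos : 0 < φ r := pos_iff_ne_zero.2 fun h0 => hr.ne' ((hφ r hr.le).1 h0)
  obtain ⟨N, hN⟩ := eventually_atTop.1 (hlim.eventually_lt_const hpos)
  refine ⟨N, fun n hn => ?_⟩
  rw [dist_eq_norm]
  by_contra! hle
  exact (hN n hn.le).not_ge (hmono hr.le (norm_nonneg _) hle)

theorem stmt14 {m : ℕ}
    {H : Type*} [NormedAddCommGroup H] [InnerProductSpace ℝ H] [CompleteSpace H]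
    {G : Fin m → Type*} [∀ i, NormedAddCommGroup (G i)] [∀ i, InnerProductSpace ℝ (G i)]
    [∀ i, CompleteSpace (G i)]
    {X : Fin m → Type*} [∀ i, NormedAddCommGroup (X i)] [∀ i, InnerProductSpace ℝ (X i)]
    [∀ i, CompleteSpace (X i)]
    {Y : Fin m → Type*} [∀ i, NormedAddCommGroup (Y i)] [∀ i, InnerProductSpace ℝ (Y i)]
    [∀ i, CompleteSpace (Y i)]
    (z : H)
    (f : H → EReal) (hf : ProperConvLsc f)
    (μ : ℝ) (hμ : 0 < μ)
    (h : H → ℝ) (hh : ProperConvLsc (fun x => (h x : EReal)))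
    (h' : H → H) (hgrad : ∀ x, HasGradientAt h (h' x) x)
    (hlip : ∀ x y : H, ‖h' x - h' y‖ ≤ μ * ‖x - y‖)
    (r : ∀ i, G i)
    (g : ∀ i, X i → EReal) (hg : ∀ i, ProperConvLsc (g i))
    (l : ∀ i, Y i → EReal) (hl : ∀ i, ProperConvLsc (l i))
    (L : ∀ i, H →L[ℝ] G i) (hL : ∀ i, L i ≠ 0)
    (K : ∀ i, G i →L[ℝ] X i) (hK : ∀ i, K i ≠ 0)
    (M : ∀ i, G i →L[ℝ] Y i) (hM : ∀ i, M i ≠ 0)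
    -- range condition
    (hran : ∃ (x : H) (u : H) (w : ∀ i, G i), u ∈ esubdiff f x ∧
        (∀ i, w i ∈ parOp (compOp (K i) (esubdiff (g i))) (compOp (M i) (esubdiff (l i)))
          (L i x - r i)) ∧
        z = u + ∑ i, ContinuousLinearMap.adjoint (L i) (w i) + h' x)
    -- step sizes
    (τ : ℝ) (hτ : 0 < τ)
    (θ1 θ2 γ1 γ2 σ : Fin m → ℝ)
    (hθ1 : ∀ i, 0 < θ1 i) (hθ2 : ∀ i, 0 < θ2 i)
    (hγ1 : ∀ i, 0 < γ1 i) (hγ2 : ∀ i, 0 < γ2 i) (hσ : ∀ i, 0 < σ i)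
    (α : ℝ)
    (hα : IsGreatest ({Real.sqrt (τ * ∑ i, σ i * ‖L i‖ ^ 2)} ∪
        Set.range (fun j => Real.sqrt (θ1 j * γ1 j * ‖K j‖ ^ 2)) ∪
        Set.range (fun j => Real.sqrt (θ2 j * γ2 j * ‖M j‖ ^ 2))) α)
    -- `2 μ⁻¹ (1 - α) · min{1/τ, 1/θ1ᵢ, 1/θ2ᵢ, 1/γ1ᵢ, 1/γ2ᵢ, 1/σᵢ} > 1`
    (hstep : 1 < 2 * μ⁻¹ * (1 - α) * (1 / τ) ∧ ∀ i,
        1 < 2 * μ⁻¹ * (1 - α) * (1 / θ1 i) ∧ 1 < 2 * μ⁻¹ * (1 - α) * (1 / θ2 i) ∧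
        1 < 2 * μ⁻¹ * (1 - α) * (1 / γ1 i) ∧ 1 < 2 * μ⁻¹ * (1 - α) * (1 / γ2 i) ∧
        1 < 2 * μ⁻¹ * (1 - α) * (1 / σ i))
    -- relaxation parameters
    (ε : ℝ) (hε : ε ∈ Set.Ioo (0:ℝ) 1) (lam : ℕ → ℝ) (hlam : ∀ n, lam n ∈ Set.Icc ε 1)
    -- the sequences generated by Algorithm 4.3
    (x xt : ℕ → H)
    (p pt : ℕ → ∀ i, X i) (q qt : ℕ → ∀ i, Y i)
    (zz zt y yt v vt u1 u2 : ℕ → ∀ i, G i)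
    (hxt : ∃ j : ℕ → H,
      (∀ n, IsProx τ f
        (x n - τ • (h' (x n) + ∑ i, ContinuousLinearMap.adjoint (L i) (v n i) - z)) (j n)) ∧
      Summable (fun n => ‖xt n - j n‖))
    (hpt : ∀ i, ∃ j : ℕ → X i,
      (∀ n, IsProx (θ1 i) (econj (g i)) (p n i + θ1 i • K i (zz n i)) (j n)) ∧
      Summable (fun n => ‖pt n i - j n‖))
    (hqt : ∀ i, ∃ j : ℕ → Y i,
      (∀ n, IsProx (θ2 i) (econj (l i)) (q n i + θ2 i • M i (y n i)) (j n)) ∧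
      Summable (fun n => ‖qt n i - j n‖))
    (hu1 : ∀ i, Summable (fun n => ‖u1 n i - (zz n i + γ1 i •
        (ContinuousLinearMap.adjoint (K i) (p n i - (2:ℝ) • pt n i) + v n i +
          σ i • (L i ((2:ℝ) • xt n - x n) - r i)))‖))
    (hu2 : ∀ i, Summable (fun n => ‖u2 n i - (y n i + γ2 i •
        (ContinuousLinearMap.adjoint (M i) (q n i - (2:ℝ) • qt n i) + v n i +
          σ i • (L i ((2:ℝ) • xt n - x n) - r i)))‖))
    (hzt : ∀ i, Summable (fun n => ‖zt n i -
        ((1 + σ i * γ2 i) / (1 + σ i * (γ1 i + γ2 i))) •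
          (u1 n i - (σ i * γ1 i / (1 + σ i * γ2 i)) • u2 n i)‖))
    (hyt : ∀ i, Summable (fun n => ‖yt n i -
        (1 / (1 + σ i * γ2 i)) • (u2 n i - (σ i * γ2 i) • zt n i)‖))
    (hvt : ∀ i, Summable (fun n => ‖vt n i -
        (v n i + σ i • (L i ((2:ℝ) • xt n - x n) - r i - zt n i - yt n i))‖))
    (hx : ∀ n, x (n+1) = x n + lam n • (xt n - x n))
    (hp : ∀ n i, p (n+1) i = p n i + lam n • (pt n i - p n i))
    (hq : ∀ n i, q (n+1) i = q n i + lam n • (qt n i - q n i))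
    (hz : ∀ n i, zz (n+1) i = zz n i + lam n • (zt n i - zz n i))
    (hy : ∀ n i, y (n+1) i = y n i + lam n • (yt n i - y n i))
    (hv : ∀ n i, v (n+1) i = v n i + lam n • (vt n i - v n i))
    -- the optimal solution of (P) to which `x` converges weakly
    (xb : H)
    (hxb : (∀ x' : H, Pval z f h g l r L K M xb ≤ Pval z f h g l r L K M x') ∧ WConv x xb)
    -- `h` is uniformly convex at `xb`
    (hunif : ∃ φ : ℝ → ℝ≥0∞, MonotoneOn φ (Set.Ici 0) ∧
      (∀ t : ℝ, 0 ≤ t → (φ t = 0 ↔ t = 0)) ∧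
      (∀ (x' : H) (lam : ℝ), lam ∈ Set.Ioo (0:ℝ) 1 →
        ((h (lam • x' + (1 - lam) • xb) : ℝ) : EReal) ≤
          ((lam : ℝ) : EReal) * ((h x' : ℝ) : EReal) +
            ((1 - lam : ℝ) : EReal) * ((h xb : ℝ) : EReal) -
            ((lam * (1 - lam) : ℝ) : EReal) * (φ ‖x' - xb‖ : EReal))) :
    Tendsto x atTop (𝓝 xb) := by
  obtain ⟨xs, us, ws, hus, hws, hzs⟩ := hran
  have hkkt : ∀ i, ∃ (ps : X i) (qs : Y i) (zs ys : G i), ps ∈ esubdiff (g i) (K i zs) ∧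
      qs ∈ esubdiff (l i) (M i ys) ∧ (K i).adjoint ps = ws i ∧ (M i).adjoint qs = ws i ∧
      L i xs - r i = zs + ys := by
    intro i
    obtain ⟨zs, ⟨ps, hps, hKp⟩, ys, ⟨qs, hqs, hMq⟩, hsum⟩ := hws i
    exact ⟨ps, qs, zs, ys, hps, hqs, hKp, hMq, hsum⟩
  choose ps qs zs ys hps hqs hKp hMq hLs using hkkt
  obtain ⟨xj, hxj, sx⟩ := hxt
  choose pj hpj sp using hpt
  choose qj hqj sq using hqt
  have himp := fun i => exists_implicit_step (L i) (K i).adjoint (M i).adjoint (r i) (hγ1 i)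
    (hγ2 i) (hσ i) (x := x) (p := fun n => p n i) (q := fun n => q n i) (v := fun n => v n i)
    sx (sp i) (sq i) (hu1 i) (hu2 i) (hzt i) (hyt i) (hvt i)
  choose zj yj vj hzj hyj hvj sz sy sv using himp
  have hconv : ConvexOn ℝ Set.univ h := by
    refine ⟨convex_univ, fun x _ y _ a b ha hb hab => ?_⟩
    have := hh.2.2.1 x y a b ha hb hab
    rw [← EReal.coe_mul, ← EReal.coe_mul, ← EReal.coe_add, EReal.coe_le_coe_iff] at this
    exact this
  -- a slightly larger `α` that is positive
  obtain ⟨α', hα0, hα1, hαα, hαμ⟩ : ∃ α' : ℝ, 0 < α' ∧ α' < 1 ∧ α ≤ α' ∧ μ * τ / 2 < 1 - α' := by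
    have hα0 : 0 ≤ α := (Real.sqrt_nonneg _).trans (hα.2 (Or.inl (Or.inl rfl)))
    have h1 : μ * τ / 2 < 1 - α := by
      have h2 := hstep.1
      have h3 : 2 * μ⁻¹ * (1 - α) * (1 / τ) = (1 - α) / (μ * τ / 2) := by field_simp
      rw [h3, one_lt_div (by positivity)] at h2
      exact h2
    have h4 : 0 < μ * τ / 2 := by positivity
    exact ⟨(α + (1 - μ * τ / 2)) / 2, by linarith, by linarith, by linarith, by linarith⟩
  have hLα : τ * ∑ i, σ i * ‖L i‖ ^ 2 ≤ α' ^ 2 :=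
    (Real.sqrt_le_left hα0.le).1 ((hα.2 (Or.inl (Or.inl rfl))).trans hαα)
  have hKα : ∀ i, θ1 i * γ1 i * ‖K i‖ ^ 2 ≤ α' ^ 2 := fun i =>
    (Real.sqrt_le_left hα0.le).1 ((hα.2 (Or.inl (Or.inr ⟨i, rfl⟩))).trans hαα)
  have hMα : ∀ i, θ2 i * γ2 i * ‖M i‖ ^ 2 ≤ α' ^ 2 := fun i =>
    (Real.sqrt_le_left hα0.le).1 ((hα.2 (Or.inr ⟨i, rfl⟩)).trans hαα)
  set ρ := (1 - α') / τ with hρ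
  have hρ0 : 0 < ρ := div_pos (by linarith) hτ
  have hc : 0 < 2 * μ⁻¹ - ρ⁻¹ := by
    have h1 : μ / 2 < ρ := by
      rw [hρ, lt_div_iff₀ hτ]
      linarith
    have h2 : ρ⁻¹ < (μ / 2)⁻¹ := inv_strictAnti₀ (by positivity) h1
    have h4 : (μ / 2)⁻¹ = 2 * μ⁻¹ := by rw [inv_div, div_eq_mul_inv]
    linarith
  set B := metricForm τ θ1 θ2 γ1 γ2 σ L K M with hB
  have hBcomm : ∀ u w, B u w = B w u := metricForm_comm τ θ1 θ2 γ1 γ2 σ L K M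
  have hBρ : ∀ u, ρ * ‖u.1‖ ^ 2 ≤ B u u :=
    le_metricForm_self hτ hθ1 hθ2 hγ1 hγ2 hσ hα0 hα1.le L K M hLα hKα hMα
  have hB0 : ∀ u, 0 ≤ B u u := fun u => le_trans (by positivity) (hBρ u)
  obtain ⟨C, hC0, hC⟩ := exists_metricForm_self_le hτ hθ1 hθ2 hγ1 hγ2 hσ hα0 L K M hKα hMα
  -- the iterates, the exact and the inexact forward-backward steps, and the solution
  set s : ℕ → H × ∀ i, X i × Y i × G i × G i × G i :=
    fun n => (x n, fun i => (p n i, q n i, zz n i, y n i, v n i)) with hs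
  set t : ℕ → H × ∀ i, X i × Y i × G i × G i × G i :=
    fun n => (xj n, fun i => (pj i n, qj i n, zj i n, yj i n, vj i n)) with ht
  set e : ℕ → H × ∀ i, X i × Y i × G i × G i × G i := fun n => (xt n - xj n, fun i =>
    (pt n i - pj i n, qt n i - qj i n, zt n i - zj i n, yt n i - yj i n, vt n i - vj i n)) with he
  set S : H × ∀ i, X i × Y i × G i × G i × G i :=
    (xs, fun i => (ps i, qs i, zs i, ys i, ws i)) with hS
  have hse : Summable fun n => ‖e n‖ :=
    summable_norm_prodMk sx (summable_norm_pi fun i => summable_norm_prodMk (sp i)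
      (summable_norm_prodMk (sq i) (summable_norm_prodMk (sz i)
        (summable_norm_prodMk (sy i) (sv i)))))
  have hrec : ∀ n, s (n + 1) - S =
      (1 - lam n) • (s n - S) + lam n • (t n - S) + lam n • e n := by
    intro n
    have h1 : s (n + 1) = s n + lam n • (t n + e n - s n) := by
      refine Prod.ext ?_ (funext fun i => ?_)
      · simp [hs, ht, he, hx]
      · simp [hs, ht, he, hp, hq, hz, hy, hv]
    rw [h1]
    module
  have hdec : ∀ n, B (t n - S) (t n - S) + (2 * μ⁻¹ - ρ⁻¹) * ‖h' (x n) - h' xs‖ ^ 2 ≤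
      B (s n - S) (s n - S) := by
    intro n
    have hst : s n - S = (t n - S) + (s n - t n) := by abel
    rw [hst]
    refine forwardBackward_decrease B hBcomm hρ0 hBρ ?_ ?_
    · have h1 : (t n - S).1 + (s n - t n).1 = x n - xs := by
        rw [← Prod.fst_add, ← hst]
        rfl
      rw [h1]
      exact norm_sub_sq_le_of_convexOn_of_lipschitz_gradient hμ hconv hgrad hlip (x n) xs
    · refine inner_le_metricForm hτ hθ1 hθ2 hγ1 hγ2 hσ L K M
        (δ := h' (x n) - h' xs) (dx := xj n - xs) (ex := x n - xj n)
        (dp := fun i => pj i n - ps i) (ep := fun i => p n i - pj i n)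
        (dq := fun i => qj i n - qs i) (eq := fun i => q n i - qj i n)
        (dz := fun i => zj i n - zs i) (ez := fun i => zz n i - zj i n)
        (dy := fun i => yj i n - ys i) (ey := fun i => y n i - yj i n)
        (dv := fun i => vj i n - ws i) (ev := fun i => v n i - vj i n)
        ?_ (fun i => ?_) (fun i => ?_) (fun i => ?_) (fun i => ?_) (fun i => ?_)
      · have h1 := IsProx.inner_nonneg hf.2.1 hf.2.2.1 hτ (hxj n) hus
        convert h1 using 2
        have h2 : us = z - ∑ i, (L i).adjoint (ws i) - h' xs := by rw [hzs]; abel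
        have h3 : ∑ i, (L i).adjoint (vj i n - ws i + (v n i - vj i n)) =
            ∑ i, (L i).adjoint (v n i) - ∑ i, (L i).adjoint (ws i) := by
          rw [← Finset.sum_sub_distrib]
          exact Finset.sum_congr rfl fun i _ => by rw [← map_sub]; congr 1; abel
        rw [h2, h3]
        module
      · have h1 := IsProx.inner_nonneg (econj_ne_bot (hg i).1) (econj_convex (hg i).2.1)
          (hθ1 i) (hpj i n) (mem_esubdiff_econj (hps i))
        convert h1 using 2
        simp only [map_add, map_sub]
        module
      · have h1 := IsProx.inner_nonneg (econj_ne_bot (hl i).1) (econj_convex (hl i).2.1)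
          (hθ2 i) (hqj i n) (mem_esubdiff_econj (hqs i))
        convert h1 using 2
        simp only [map_add, map_sub]
        module
      · have h1 := hzj i n
        simp only [map_sub, map_smul, hKp] at h1 ⊢
        nth_rewrite 1 [h1]
        module
      · have h1 := hyj i n
        simp only [map_sub, map_smul, hMq] at h1 ⊢
        nth_rewrite 1 [h1]
        module
      · have h1 := hvj i n
        have h2 := hLs i
        have h3 : L i xs = r i + zs i + ys i := by
          rw [sub_eq_iff_eq_add] at h2
          rw [h2]
          abel
        simp only [map_sub, map_smul, h3] at h1 ⊢
        nth_rewrite 1 [h1]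
        module
  obtain ⟨⟨R, hR⟩, hlim⟩ := quasi_fejer (a := fun n => √(B (s n - S) (s n - S)))
    (b := fun n => √(B (t n - S) (t n - S))) (d := fun n => ‖h' (x n) - h' xs‖)
    (η := fun n => √C * ‖e n‖) hc hε.1 hlam (fun _ => Real.sqrt_nonneg _)
    (fun _ => by positivity) (hse.mul_left _)
    (fun n => by
      have h0 := hε.1.le.trans (hlam n).1
      have h1 : √(B (e n) (e n)) ≤ √C * ‖e n‖ := by
        rw [← Real.sqrt_sq (norm_nonneg (e n)), ← Real.sqrt_mul hC0]
        exact Real.sqrt_le_sqrt (hC _)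
      have h2 : lam n * √(B (e n) (e n)) ≤ √C * ‖e n‖ :=
        (mul_le_of_le_one_left (Real.sqrt_nonneg _) (hlam n).2).trans h1
      have h3 := B.sqrt_apply_add_le hB0 hBcomm
        ((1 - lam n) • (s n - S) + lam n • (t n - S)) (lam n • e n)
      have h4 := B.sqrt_apply_add_le hB0 hBcomm ((1 - lam n) • (s n - S)) (lam n • (t n - S))
      rw [B.sqrt_apply_smul h0] at h3
      rw [B.sqrt_apply_smul h0, B.sqrt_apply_smul (sub_nonneg.2 (hlam n).2)] at h4
      rw [hrec n]
      linarith)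
    (fun n => by
      rw [Real.sq_sqrt (hB0 _), Real.sq_sqrt (hB0 _)]
      exact hdec n)
  have hbdd : ∀ n, ‖x n - xs‖ ≤ √(R ^ 2 / ρ) := by
    intro n
    refine Real.le_sqrt_of_sq_le ((le_div_iff₀ hρ0).2 ?_)
    rw [mul_comm]
    exact (hBρ (s n - S)).trans ((Real.sqrt_le_iff.1 (hR n)).2)
  obtain ⟨φ, hmono, hφ, hφh⟩ := hunif
  refine tendsto_of_tendsto_inner_gradient hconv hgrad hmono hφ hφh ?_
  have h1 : Tendsto (fun n => ⟪h' (x n) - h' xs, x n - xb⟫) atTop (𝓝 0) := by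
    have h2 := hlim.mul_const (√(R ^ 2 / ρ) + ‖xs - xb‖)
    rw [zero_mul] at h2
    refine squeeze_zero_norm (fun n => (norm_inner_le_norm _ _).trans ?_) h2
    have h3 := norm_sub_le_norm_sub_add_norm_sub (x n) xs xb
    gcongr
    exact h3.trans (by gcongr; exact hbdd n)
  have h2 : Tendsto (fun n => ⟪h' xs - h' xb, x n - xb⟫) atTop (𝓝 0) := by
    have h3 := (hxb.2 (h' xs - h' xb)).sub_const ⟪xb, h' xs - h' xb⟫
    rw [sub_self] at h3
    refine h3.congr fun n => ?_
    rw [← inner_sub_left]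
    exact real_inner_comm _ _
  have h3 := h1.add h2
  rw [add_zero] at h3
  simpa only [← inner_add_left, sub_add_sub_cancel] using h3
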